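/- arXiv:2512.05480 — 3 statements merged into one kernel-verified Lean document; each statement's English description precedes it below -/
import Mathlib

section
/- Let n ≥ 2 and let a, b be integers with 0 < a < b < n. If 3 divides none of a, b, 2n − a, 2n − b, and n, then the 5-regular circulant graph C_{2n}(a,b,n) is word-representable. -/
/-- Two letters `x` and `y` alternate in the word `w` if, after deleting all letters
other than `x` and `y`, no two consecutive letters of the resulting word are equal. -/
def Alternate {V : Type*} [DecidableEq V] (w : List V) (x y : V) : Prop :=
  (w.filter (fun z => decide (z = x ∨ z = y))).Chain' (· ≠ ·)

/-- A word `w` represents the graph `G` if it contains every vertex at least once and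
two distinct vertices are adjacent in `G` iff they alternate in `w`. -/
def Represents {V : Type*} [DecidableEq V] (G : SimpleGraph V) (w : List V) : Prop :=
  (∀ v : V, v ∈ w) ∧ ∀ x y : V, x ≠ y → (G.Adj x y ↔ Alternate w x y)

/-- A graph is word-representable if some word represents it. -/
def WordRepresentable {V : Type*} [DecidableEq V] (G : SimpleGraph V) : Prop :=
  ∃ w : List V, Represents G w

/-- A word is `k`-uniform if every letter of the alphabet occurs in it exactly `k` times. -/
def IsKUniform {V : Type*} [DecidableEq V] (w : List V) (k : ℕ) : Prop :=
  ∀ v : V, w.count v = k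

section LayerWords

variable {V : Type*}

/-- The word obtained by listing, for each predicate of `ps` in turn, the letters of `L`
satisfying it. -/
def layerWord (L : List V) (ps : List (V → Bool)) : List V :=
  ps.flatMap fun p => L.filter p

theorem filter_layerWord (L : List V) (ps : List (V → Bool)) (q : V → Bool) :
    (layerWord L ps).filter q = layerWord (L.filter q) ps := by
  simp only [layerWord, List.filter_flatMap, List.filter_filter, Bool.and_comm]

theorem isChain_flatten_replicate_pair {x y : V} (hxy : x ≠ y) (k : ℕ) :
    (List.replicate k [x, y]).flatten.IsChain (· ≠ ·) := by
  induction k with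
  | zero => simp
  | succ k ih =>
    cases k with
    | zero => simpa using hxy
    | succ k =>
      simp only [List.replicate_succ, List.flatten_cons, List.cons_append, List.nil_append,
        List.isChain_cons_cons] at ih ⊢
      exact ⟨hxy, hxy.symm, ih⟩

theorem exists_flatMap_eq_flatten_replicate {ι : Type*} (l : List ι) (g : ι → List V)
    (u : List V) (h : ∀ i ∈ l, ∃ k, g i = (List.replicate k u).flatten) :
    ∃ k, l.flatMap g = (List.replicate k u).flatten := by
  induction l with
  | nil => exact ⟨0, by simp⟩
  | cons i l ih =>
    obtain ⟨k, hk⟩ := h i (by simp)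
    obtain ⟨m, hm⟩ := ih fun j hj => h j (by simp [hj])
    exact ⟨k + m, by rw [List.flatMap_cons, hk, hm, List.replicate_add, List.flatten_append]⟩

variable [DecidableEq V]

theorem Alternate.symm {w : List V} {x y : V} (h : Alternate w x y) : Alternate w y x := by
  unfold Alternate at *
  simpa only [or_comm] using h

theorem Alternate.of_infix {u w : List V} {x y : V} (h : Alternate w x y) (hu : u <:+: w) :
    Alternate u x y :=
  List.IsChain.infix h (hu.filter _)

theorem filter_pair_of_nodup {L : List V} (hL : L.Nodup) {x y : V} (hx : x ∈ L) (hy : y ∈ L)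
    (hxy : x ≠ y) :
    L.filter (fun z => decide (z = x ∨ z = y)) = [x, y] ∨
      L.filter (fun z => decide (z = x ∨ z = y)) = [y, x] := by
  have hp : (L.filter (fun z => decide (z = x ∨ z = y))).Perm [x, y] := by
    rw [List.perm_ext_iff_of_nodup (hL.filter _) (by simpa using hxy)]
    intro z
    simp only [List.mem_filter, decide_eq_true_eq, List.mem_cons, List.not_mem_nil, or_false]
    constructor
    · exact fun h => h.2
    · rintro (rfl | rfl) <;> simp [hx, hy]
  generalize L.filter (fun z => decide (z = x ∨ z = y)) = M at hp
  match M, hp.length_eq with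
  | [u, v], _ =>
    have hu : u ∈ [x, y] := hp.subset (by simp)
    have hv : v ∈ [x, y] := hp.subset (by simp)
    have huv : [u, v].Nodup := hp.nodup_iff.2 (by simpa using hxy)
    simp at hu hv huv
    grind

/-- Layers for the vertex `v` of a graph with a proper colouring `f` by `0, 1, 2`: in the
resulting word every edge alternates starting from its endpoint of smaller colour, while
non-edges at `v` are broken. -/
def vertexLayers (G : SimpleGraph V) [DecidableRel G.Adj] (f : V → Fin 3) (v : V) :
    List (V → Bool) :=
  if f v = 0 then
    [fun z => f z = 0, fun z => f z = 1, fun z => f z = 2 ∧ G.Adj v z, fun z => z = v,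
      fun z => f z = 2 ∧ ¬ G.Adj v z, fun z => f z = 0 ∧ z ≠ v, fun z => f z = 1,
      fun z => f z = 2]
  else if f v = 1 then
    [fun z => f z = 0, fun z => f z = 1, fun z => f z = 2,
      fun z => f z = 0 ∧ G.Adj v z, fun z => z = v, fun z => f z = 0 ∧ ¬ G.Adj v z,
      fun z => f z = 1 ∧ z ≠ v, fun z => f z = 2,
      fun z => f z = 0, fun z => f z = 1 ∧ z ≠ v, fun z => f z = 2 ∧ ¬ G.Adj v z,
      fun z => z = v, fun z => f z = 2 ∧ G.Adj v z]
  else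
    [fun z => f z = 0, fun z => f z = 1, fun z => f z = 2, fun z => f z = 0,
      fun z => f z = 1, fun z => z = v, fun z => f z = 2 ∧ z ≠ v]

variable {G : SimpleGraph V} [DecidableRel G.Adj] {f : V → Fin 3}

theorem layerWord_vertexLayers_of_adj {x y : V} (hadj : G.Adj x y) (hf : f x < f y) (v : V)
    {M : List V} (hM : M = [x, y] ∨ M = [y, x]) :
    ∃ k, layerWord M (vertexLayers G f v) = (List.replicate k [x, y]).flatten := by
  have hne := hadj.ne
  have hcol : (f x = 0 ∧ f y = 1) ∨ (f x = 0 ∧ f y = 2) ∨ (f x = 1 ∧ f y = 2) := by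
    revert hf; generalize f x = i; generalize f y = j; revert i j; decide
  suffices h : layerWord M (vertexLayers G f v) = (List.replicate 2 [x, y]).flatten ∨
      layerWord M (vertexLayers G f v) = (List.replicate 3 [x, y]).flatten by
    exact h.elim (fun h => ⟨2, h⟩) (fun h => ⟨3, h⟩)
  by_cases hxv : x = v
  · subst hxv
    rcases hcol with ⟨h1, h2⟩ | ⟨h1, h2⟩ | ⟨h1, h2⟩ <;> rcases hM with rfl | rfl <;>
      simp [layerWord, vertexLayers, List.filter_cons, List.replicate_succ, h1, h2, hadj,
        hne.symm]
  by_cases hyv : y = v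
  · subst hyv
    rcases hcol with ⟨h1, h2⟩ | ⟨h1, h2⟩ | ⟨h1, h2⟩ <;> rcases hM with rfl | rfl <;>
      simp [layerWord, vertexLayers, List.filter_cons, List.replicate_succ, h1, h2, hadj.symm,
        hne]
  have hv : f v = 0 ∨ f v = 1 ∨ f v = 2 := by generalize f v = i; revert i; decide
  rcases hcol with ⟨h1, h2⟩ | ⟨h1, h2⟩ | ⟨h1, h2⟩ <;> rcases hM with rfl | rfl <;>
    rcases hv with h | h | h <;> by_cases hvx : G.Adj v x <;> by_cases hvy : G.Adj v y <;>
      simp [layerWord, vertexLayers, List.filter_cons, List.replicate_succ, h, h1, h2, hvx, hvy,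
        hxv, hyv]

theorem not_isChain_layerWord_vertexLayers {x y : V} (hne : x ≠ y) (hadj : ¬ G.Adj x y)
    (hf : f x ≤ f y) {M : List V} (hM : M = [x, y] ∨ M = [y, x]) :
    ¬ ((layerWord M (vertexLayers G f x)).IsChain (· ≠ ·) ∧
      (layerWord M (vertexLayers G f y)).IsChain (· ≠ ·)) := by
  have hadj' : ¬ G.Adj y x := fun h => hadj h.symm
  have hcol : (f x = 0 ∧ f y = 0) ∨ (f x = 1 ∧ f y = 1) ∨ (f x = 2 ∧ f y = 2) ∨
      (f x = 0 ∧ f y = 1) ∨ (f x = 0 ∧ f y = 2) ∨ (f x = 1 ∧ f y = 2) := by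
    revert hf; generalize f x = i; generalize f y = j; revert i j; decide
  rcases hcol with ⟨h1, h2⟩ | ⟨h1, h2⟩ | ⟨h1, h2⟩ | ⟨h1, h2⟩ | ⟨h1, h2⟩ | ⟨h1, h2⟩ <;>
    rcases hM with rfl | rfl <;>
      simp [layerWord, vertexLayers, List.filter_cons, h1, h2, hadj, hadj', hne, hne.symm]

/-- Every 3-colourable graph on a finite vertex set is word-representable. -/
theorem WordRepresentable.of_colorable_three [Fintype V] (G : SimpleGraph V)
    (hG : G.Colorable 3) : WordRepresentable G := by
  classical
  obtain ⟨f⟩ := hG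
  let L : List V := Finset.univ.toList
  have hmem : ∀ v, v ∈ L := fun v => by simp [L]
  have hnodup : L.Nodup := Finset.nodup_toList _
  let w : List V := L.flatMap fun v => layerWord L (vertexLayers G f v)
  have key : ∀ x y : V, x ≠ y → f x ≤ f y → (G.Adj x y ↔ Alternate w x y) := by
    intro x y hne hf
    have hpair := filter_pair_of_nodup hnodup (hmem x) (hmem y) hne
    constructor
    · intro hadj
      have hlt : f x < f y := lt_of_le_of_ne hf (f.valid hadj)
      obtain ⟨k, hk⟩ := exists_flatMap_eq_flatten_replicate L
        (fun v => (layerWord L (vertexLayers G f v)).filter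
          (fun z => decide (z = x ∨ z = y))) [x, y] fun v _ => by
            rw [filter_layerWord]
            exact layerWord_vertexLayers_of_adj hadj hlt v hpair
      change List.IsChain _ (w.filter _)
      rw [List.filter_flatMap, hk]
      exact isChain_flatten_replicate_pair hne k
    · intro halt
      by_contra hadj
      have hchain : ∀ v, (layerWord (L.filter (fun z => decide (z = x ∨ z = y)))
          (vertexLayers G f v)).IsChain (· ≠ ·) := by
        intro v
        rw [← filter_layerWord]
        exact halt.of_infix (List.infix_flatMap_of_mem (hmem v)
          fun v => layerWord L (vertexLayers G f v))
      exact not_isChain_layerWord_vertexLayers hne hadj hf hpair ⟨hchain x, hchain y⟩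
  refine ⟨w, fun v => ?_, fun x y hne => ?_⟩
  · refine List.mem_flatMap.2 ⟨v, hmem v, List.mem_flatMap.2 ⟨fun z => z = v, ?_, ?_⟩⟩
    · unfold vertexLayers
      split_ifs <;> simp
    · simp [hmem v]
  · rcases le_total (f x) (f y) with hf | hf
    · exact key x y hne hf
    · rw [G.adj_comm, key y x hne.symm hf]
      exact ⟨Alternate.symm, Alternate.symm⟩

end LayerWords

/-- If no jump `d` of a circulant graph, nor its complement `m - d`, is divisible by 3, then
reducing the representatives modulo 3 is a proper colouring. -/
theorem circulantGraph_colorable_three {m : ℕ} [NeZero m] (s : Set (ZMod m))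
    (hs : ∀ d ∈ s, ¬ 3 ∣ d.val ∧ ¬ 3 ∣ m - d.val) :
    (SimpleGraph.circulantGraph s).Colorable 3 := by
  have key : ∀ x y : ZMod m, x - y ∈ s → x.val % 3 ≠ y.val % 3 := by
    intro x y hxy h
    obtain ⟨h1, h2⟩ := hs _ hxy
    have hx := x.val_lt
    have hy := y.val_lt
    rcases le_total y.val x.val with hle | hle
    · rw [ZMod.val_sub hle] at h1
      omega
    · have hval : (y - x).val = y.val - x.val := ZMod.val_sub hle
      have hne : y - x ≠ 0 := by
        intro h0
        rw [sub_eq_zero] at h0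
        subst h0
        simp at h1
      have : NeZero (y - x) := ⟨hne⟩
      have hneg : (x - y).val = m - (y - x).val := by
        rw [← neg_sub, ZMod.val_neg_of_ne_zero]
      omega
  refine ⟨SimpleGraph.Coloring.mk (fun x => ⟨x.val % 3, Nat.mod_lt _ (by norm_num)⟩) ?_⟩
  intro x y hadj h
  simp only [Fin.mk.injEq] at h
  rw [SimpleGraph.circulantGraph, SimpleGraph.fromRel_adj] at hadj
  rcases hadj.2 with h' | h'
  · exact key _ _ h' h
  · exact key _ _ h' h.symm

theorem stmt3 (n a b : ℕ) (hn : 2 ≤ n)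
    (ha : 0 < a) (hab : a < b) (hbn : b < n)
    (h1 : ¬ (3 ∣ a)) (h2 : ¬ (3 ∣ b)) (h3 : ¬ (3 ∣ (2*n - a)))
    (h4 : ¬ (3 ∣ (2*n - b))) (h5 : ¬ (3 ∣ n)) :
    WordRepresentable (SimpleGraph.circulantGraph {((a : ℕ) : ZMod (2*n)), ((b : ℕ) : ZMod (2*n)), ((n : ℕ) : ZMod (2*n))}) := by
  have : NeZero (2 * n) := ⟨by omega⟩
  apply WordRepresentable.of_colorable_three
  apply circulantGraph_colorable_three
  rintro d (rfl | rfl | rfl)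
  · rw [ZMod.val_natCast_of_lt (by omega)]
    exact ⟨h1, h3⟩
  · rw [ZMod.val_natCast_of_lt (by omega)]
    exact ⟨h2, h4⟩
  · rw [ZMod.val_natCast_of_lt (by omega)]
    exact ⟨h5, by omega⟩
end

section
/- Let n ≥ 3 and let x be an integer with 1 < x < n. If n ≡ 2 (mod 3) and x ≡ 2 (mod 3), then the 5-regular circulant graph C_{2n}(x,1,n) is word-representable. -/
/-- A list without repetitions restricts to one of the two orderings of a pair of its members. -/
theorem filter_pair_of_nodup_s5 {V : Type*} [DecidableEq V] {L : List V} (hL : L.Nodup) {a b : V}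
    (ha : a ∈ L) (hb : b ∈ L) (hab : a ≠ b) :
    L.filter (fun z => decide (z = a ∨ z = b)) = [a, b] ∨
      L.filter (fun z => decide (z = a ∨ z = b)) = [b, a] := by
  have h : (L.filter (fun z => decide (z = a ∨ z = b))).Perm [a, b] := by
    rw [List.perm_ext_iff_of_nodup (hL.filter _) (by simpa using hab)]
    intro z
    simp only [List.mem_filter, decide_eq_true_eq, List.mem_cons, List.not_mem_nil, or_false]
    constructor
    · exact fun h => h.2
    · rintro (rfl | rfl) <;> simp [*]
  have hmem := List.mem_permutations.2 h
  simpa [List.permutations, List.permutationsAux, List.permutationsAux.rec] using hmem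

theorem isChain_flatMap_pair {ι V : Type*} {a b : V} (hab : a ≠ b) (l : List ι) :
    (b :: l.flatMap fun _ => [a, b, a, b]).IsChain (· ≠ ·) := by
  induction l with
  | nil => simp
  | cons i l ih => simpa [hab, hab.symm] using ih

section SemiTransitive

variable {V : Type*} [DecidableEq V] (R : V → V → Prop)

open Classical in
/-- The position of `z` relative to `v` in the digraph `R`: `0` for non-adjacent ancestors,
`1` for in-neighbours, `3` for `v` itself, `4` for out-neighbours, `5` for non-adjacent
descendants and `2` for all remaining vertices. -/
noncomputable def vertexClass (v z : V) : ℕ :=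
  if z = v then 3 else if R z v then 1 else if Relation.TransGen R z v then 0
  else if R v z then 4 else if Relation.TransGen R v z then 5 else 2

/-- The order in which the blocks of vertices of equal class are concatenated in `vertexWord`. -/
def blockOrder : List ℕ := [0, 1, 2, 0, 3, 4, 1, 3, 5, 2, 4, 5]

/-- A 2-uniform word in which the ends of every arc alternate, but `v` alternates only with its
neighbours. -/
noncomputable def vertexWord (L : List V) (v : V) : List V :=
  blockOrder.flatMap fun k => L.filter fun z => decide (vertexClass R v z = k)

theorem filter_vertexWord (L : List V) (v : V) (p : V → Bool) :
    (vertexWord R L v).filter p = vertexWord R (L.filter p) v := by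
  simp only [vertexWord, List.filter_flatMap, List.filter_filter, Bool.and_comm]

variable {R}

/-- In the word of any vertex, the ends of an arc of a semi-transitive digraph alternate, starting
with the tail. -/
theorem vertexWord_pair_of_arc (hirr : ∀ a, ¬ Relation.TransGen R a a)
    (hst : ∀ a v b, Relation.TransGen R a v → Relation.TransGen R v b → R a b → R a v ∧ R v b)
    {a b : V} (hab : R a b) (v : V) : vertexWord R [a, b] v = [a, b, a, b] := by
  have hne : a ≠ b := by rintro rfl; exact hirr a (.single hab)
  have h1 : Relation.TransGen R b v → Relation.TransGen R a v := .head hab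
  have h2 : Relation.TransGen R v a → Relation.TransGen R v b := fun h => h.tail hab
  have h3 := hst a v b
  have h4 : R a v → Relation.TransGen R b v → R b v := fun h h' => (hst a b v (.single hab) h' h).2
  have h5 : R v b → Relation.TransGen R v a → R v a := fun h h' => (hst v a b h' (.single hab) h).1
  have h6 : Relation.TransGen R a v → Relation.TransGen R v a → False :=
    fun h h' => hirr a (h.trans h')
  have h7 : Relation.TransGen R b v → Relation.TransGen R v b → False :=
    fun h h' => hirr b (h.trans h')
  have s1 : R a v → Relation.TransGen R a v := .single
  have s2 : R v a → Relation.TransGen R v a := .single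
  have s3 : R b v → Relation.TransGen R b v := .single
  have s4 : R v b → Relation.TransGen R v b := .single
  have key : (vertexClass R v a, vertexClass R v b) ∈ ([(0, 0), (0, 1), (1, 1), (0, 2), (1, 2),
      (2, 2), (1, 3), (3, 4), (1, 4), (2, 4), (2, 5), (4, 4), (4, 5), (5, 5)] : List (ℕ × ℕ)) := by
    by_cases hav : a = v
    · subst hav
      simp [vertexClass, hne.symm, hab]
      grind
    · by_cases hbv : b = v
      · subst hbv
        simp [vertexClass, hne, hab]
      · clear hirr hst
        simp only [vertexClass, if_neg hav, if_neg hbv]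
        split_ifs <;> first | (simp; done) | (exfalso; simp_all)
  simp only [List.mem_cons, Prod.mk.injEq, List.not_mem_nil, or_false] at key
  rcases key with h | h | h | h | h | h | h | h | h | h | h | h | h | h <;>
    simp [vertexWord, blockOrder, h.1, h.2]

/-- A vertex does not alternate with a non-neighbour in its own word. -/
theorem not_isChain_vertexWord {v b : V} (hne : b ≠ v) (h1 : ¬ R v b) (h2 : ¬ R b v) :
    ¬ (vertexWord R [v, b] v).IsChain (· ≠ ·) ∧ ¬ (vertexWord R [b, v] v).IsChain (· ≠ ·) := by
  have hv : vertexClass R v v = 3 := by simp [vertexClass]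
  have hb : vertexClass R v b = 0 ∨ vertexClass R v b = 5 ∨ vertexClass R v b = 2 := by
    simp only [vertexClass, if_neg hne, if_neg h1, if_neg h2]
    grind
  rcases hb with hb | hb | hb <;> simp [vertexWord, blockOrder, hv, hb]

/-- A graph with a semi-transitive orientation is word-representable. -/
theorem wordRepresentable_of_semiTransitive [Fintype V] {G : SimpleGraph V}
    (hG : ∀ a b, G.Adj a b ↔ R a b ∨ R b a) (r : V → ℕ) (hr : ∀ a b, R a b → r a < r b)
    (hst : ∀ a v b, Relation.TransGen R a v → Relation.TransGen R v b → R a b → R a v ∧ R v b) :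
    WordRepresentable G := by
  have hirr : ∀ a, ¬ Relation.TransGen R a a := by
    have : ∀ a b, Relation.TransGen R a b → r a < r b := by
      intro a b h
      induction h with
      | single h => exact hr _ _ h
      | tail _ h ih => exact ih.trans (hr _ _ h)
    exact fun a h => lt_irrefl _ (this a a h)
  obtain ⟨L, hmem, hnd, hsort⟩ : ∃ L : List V, (∀ v, v ∈ L) ∧ L.Nodup ∧
      L.Pairwise (fun p q => r p ≤ r q) := by
    refine ⟨(Finset.univ : Finset V).toList.mergeSort (fun p q => decide (r p ≤ r q)), ?_, ?_, ?_⟩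
    · simp
    · exact (List.mergeSort_perm _ _).nodup_iff.2 (Finset.nodup_toList _)
    · have := List.pairwise_mergeSort (le := fun p q : V => decide (r p ≤ r q))
        (by intro a b c; simpa using le_trans) (by intro a b; simpa using le_total (r a) (r b))
        (Finset.univ : Finset V).toList
      simpa using this
  have hfilter : ∀ a b, (L.flatMap (vertexWord R L)).filter (fun z => decide (z = a ∨ z = b)) =
      L.flatMap (vertexWord R (L.filter fun z => decide (z = a ∨ z = b))) := by
    intro a b
    simp only [List.filter_flatMap, filter_vertexWord]
  have harc : ∀ a b, R a b → Alternate (L.flatMap (vertexWord R L)) a b := by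
    intro a b hab
    have hne : a ≠ b := by rintro rfl; exact hirr a (.single hab)
    have hpair : L.filter (fun z => decide (z = a ∨ z = b)) = [a, b] := by
      refine (filter_pair_of_nodup_s5 hnd (hmem a) (hmem b) hne).resolve_right fun h => ?_
      have hp := hsort.filter (fun z => decide (z = a ∨ z = b))
      rw [h] at hp
      have := hr a b hab
      simp at hp
      omega
    change List.IsChain _ _
    rw [hfilter, hpair, funext (vertexWord_pair_of_arc hirr hst hab)]
    exact (isChain_flatMap_pair hne L).tail
  have hcomm : ∀ w : List V, ∀ a b, Alternate w a b → Alternate w b a := by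
    intro w a b h
    simpa only [Alternate, or_comm] using h
  refine ⟨L.flatMap (vertexWord R L), fun v => ?_, fun a b hne => ⟨fun h => ?_, fun h => ?_⟩⟩
  · refine List.mem_flatMap.2 ⟨v, hmem v, List.mem_flatMap.2 ⟨3, by simp [blockOrder], ?_⟩⟩
    simp [hmem, vertexClass]
  · rcases (hG a b).1 h with h | h
    · exact harc a b h
    · exact hcomm _ _ _ (harc b a h)
  · by_contra hadj
    rw [hG, not_or] at hadj
    change List.IsChain _ _ at h
    rw [hfilter] at h
    have hsub := h.infix (List.infix_flatMap_of_mem (hmem a) _)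
    have hnot := not_isChain_vertexWord hne.symm hadj.1 hadj.2
    rcases filter_pair_of_nodup_s5 hnd (hmem a) (hmem b) hne with hp | hp <;> rw [hp] at hsub
    · exact hnot.1 hsub
    · exact hnot.2 hsub

end SemiTransitive

/-- A difference in `ZMod m`, in terms of least nonnegative representatives. -/
theorem val_of_sub_eq_natCast {m k : ℕ} [NeZero m] (hk : k < m) {a b : ZMod m}
    (h : a - b = (k : ZMod m)) : a.val = b.val + k ∨ a.val + m = b.val + k := by
  have ha : a = b + (k : ZMod m) := by rw [← h]; abel
  have hb := b.val_lt
  rw [ha, ZMod.val_add, ZMod.val_natCast_of_lt hk]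
  rcases lt_or_ge (b.val + k) m with hlt | hge
  · exact .inl (Nat.mod_eq_of_lt hlt)
  · right
    rw [Nat.mod_eq_sub_mod hge, Nat.mod_eq_of_lt (by omega)]
    omega

/-- Residues modulo `3`, except that the last vertex gets a colour of its own. -/
def lastResidue (n i : ℕ) : ℕ := if i = 2 * n - 1 then 3 else i % 3

theorem stmt5 (n x : ℕ) (hn : 3 ≤ n) (hx1 : 1 < x) (hxn : x < n)
    (h0 : n % 3 = 2) (h1 : x % 3 = 2) :
    WordRepresentable (SimpleGraph.circulantGraph {((1 : ℕ) : ZMod (2*n)), ((x : ℕ) : ZMod (2*n)), ((n : ℕ) : ZMod (2*n))}) := by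
  have : NeZero (2 * n) := ⟨by omega⟩
  set G := SimpleGraph.circulantGraph
    {((1 : ℕ) : ZMod (2*n)), ((x : ℕ) : ZMod (2*n)), ((n : ℕ) : ZMod (2*n))} with hGdef
  set c : ZMod (2 * n) → ℕ := fun z => lastResidue n z.val with hc
  have hadj : ∀ a b, G.Adj a b → ∃ k, (k = 1 ∨ k = x ∨ k = n) ∧
      (a.val = b.val + k ∨ a.val + 2 * n = b.val + k ∨
        b.val = a.val + k ∨ b.val + 2 * n = a.val + k) := by
    intro a b h
    have h' : ∃ k : ℕ, (k = 1 ∨ k = x ∨ k = n) ∧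
        (a - b = (k : ZMod (2 * n)) ∨ b - a = (k : ZMod (2 * n))) := by
      simp only [hGdef, SimpleGraph.circulantGraph, SimpleGraph.fromRel_adj,
        Set.mem_insert_iff, Set.mem_singleton_iff] at h
      rcases h.2 with (h | h | h) | (h | h | h)
      exacts [⟨1, by simp, .inl h⟩, ⟨x, by simp, .inl h⟩, ⟨n, by simp, .inl h⟩,
        ⟨1, by simp, .inr h⟩, ⟨x, by simp, .inr h⟩, ⟨n, by simp, .inr h⟩]
    obtain ⟨k, hk, h | h⟩ := h'
    · have := val_of_sub_eq_natCast (by omega) h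
      exact ⟨k, hk, by tauto⟩
    · have := val_of_sub_eq_natCast (by omega) h
      exact ⟨k, hk, by tauto⟩
  have hcol : ∀ a b, G.Adj a b → c a ≠ c b := by
    intro a b h
    obtain ⟨k, hk, h⟩ := hadj a b h
    have ha := a.val_lt
    have hb := b.val_lt
    simp only [hc, lastResidue]
    split_ifs <;> omega
  have hlt : ∀ a, c a < 4 := by
    intro a
    simp only [hc, lastResidue]
    split_ifs <;> omega
  let R : ZMod (2 * n) → ZMod (2 * n) → Prop := fun a b => G.Adj a b ∧ c a < c b
  have hpath : ∀ a p q b, R a p → R p q → R q b → ¬ R a b := by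
    rintro a p q b ⟨hap, cap⟩ ⟨hpq, cpq⟩ ⟨hqb, cqb⟩ ⟨hab, -⟩
    have cb := hlt b
    obtain ⟨k₁, hk₁, hab⟩ := hadj a b hab
    obtain ⟨k₂, hk₂, hap⟩ := hadj a p hap
    obtain ⟨k₃, hk₃, hqb⟩ := hadj q b hqb
    obtain ⟨k₄, hk₄, hpq⟩ := hadj p q hpq
    have va := a.val_lt
    have vp := p.val_lt
    have vq := q.val_lt
    have vb := b.val_lt
    have b3 : b.val = 2 * n - 1 := by
      have : c b = 3 := by omega
      simp only [hc, lastResidue] at this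
      split_ifs at this <;> omega
    have hmod : ∀ z : ZMod (2 * n), c z < 3 → z.val % 3 = c z := by
      intro z hz
      simp only [hc, lastResidue] at hz ⊢
      split_ifs at hz ⊢ <;> omega
    have a0 := hmod a (by omega)
    have p1 := hmod p (by omega)
    have q2 := hmod q (by omega)
    have ha : a.val = 0 := by omega
    have hp : p.val = 1 := by omega
    have hq : q.val = 2 * n - 2 := by omega
    omega
  have hrank : ∀ a b, Relation.TransGen R a b → c a < c b := by
    intro a b h
    induction h with
    | single h => exact h.2
    | tail _ h ih => exact ih.trans h.2
  have harc : ∀ p q, Relation.TransGen R p q → c q ≤ c p + 1 → R p q := by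
    intro p q h hle
    obtain ⟨s, hps, hsq⟩ := Relation.TransGen.head'_iff.1 h
    rcases Relation.reflTransGen_iff_eq_or_transGen.1 hsq with rfl | hsq
    · exact hps
    · have := hps.2
      have := hrank _ _ hsq
      omega
  refine wordRepresentable_of_semiTransitive (R := R) (fun a b => ?_) c (fun a b h => h.2) ?_
  · refine ⟨fun h => ?_, fun h => h.elim (fun h => h.1) (fun h => h.1.symm)⟩
    rcases (hcol a b h).lt_or_gt with h' | h'
    · exact .inl ⟨h, h'⟩
    · exact .inr ⟨h.symm, h'⟩
  · intro a v b hav hvb hab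
    have := hlt b
    rcases Relation.TransGen.head'_iff.1 hav with ⟨p, hap, hpv⟩
    rcases Relation.TransGen.tail'_iff.1 hvb with ⟨q, hvq, hqb⟩
    have cap := hap.2
    have cqb := hqb.2
    rcases Relation.reflTransGen_iff_eq_or_transGen.1 hpv with rfl | hpv
    · rcases Relation.reflTransGen_iff_eq_or_transGen.1 hvq with rfl | hvq
      · exact ⟨hap, hqb⟩
      · have := hrank _ _ hvq
        exact (hpath a _ q b hap (harc _ _ hvq (by omega)) hqb hab).elim
    · have := hrank _ _ hpv
      rcases Relation.reflTransGen_iff_eq_or_transGen.1 hvq with rfl | hvq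
      · exact (hpath a p _ b hap (harc _ _ hpv (by omega)) hqb hab).elim
      · have := hrank _ _ hvq
        omega
end

section
/- Let n ≥ 3 and let x be an integer with 1 < x < n. If n ≡ 1 (mod 3), x ≡ 2 (mod 3), 2 < x, and 2x < n, then the 5-regular circulant graph C_{2n}(x,1,n) is word-representable. -/
/-- `blockWord Ss` lists, for each predicate of `Ss` in turn, the vertices satisfying it. -/
noncomputable def blockWord {V : Type*} [Fintype V] (Ss : List (V → Bool)) : List V :=
  Ss.flatMap fun S => (Finset.univ : Finset V).toList.filter S

theorem color_cases {V : Type*} {c : V → ℕ} (hc : ∀ v, c v < 3) {p q : V} (h : c p < c q) :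
    (c p = 0 ∧ c q = 1) ∨ (c p = 0 ∧ c q = 2) ∨ (c p = 1 ∧ c q = 2) := by
  have := hc q
  omega

section Words

variable {V : Type*} [DecidableEq V]

theorem filter_toList_pair [Fintype V] (S : V → Bool) {p q : V} (h : ¬(S p ∧ S q)) :
    ((Finset.univ : Finset V).toList.filter S).filter (fun z => decide (z = p ∨ z = q)) =
      if S p then [p] else if S q then [q] else [] := by
  have single (r : V) : (Finset.univ : Finset V).toList.filter (fun z => decide (z = r)) = [r] := by
    rw [List.filter_eq, List.count_eq_one_of_mem (Finset.nodup_toList _) (by simp)]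
    rfl
  rw [List.filter_filter]
  split_ifs with hp hq
  · rw [← single p]
    refine List.filter_congr fun z _ => ?_
    by_cases hz : z = p <;> by_cases hz' : z = q <;> simp_all
  · rw [← single q]
    refine List.filter_congr fun z _ => ?_
    by_cases hz : z = p <;> by_cases hz' : z = q <;> simp_all
  · refine List.filter_eq_nil_iff.2 fun z _ => ?_
    by_cases hz : z = p <;> by_cases hz' : z = q <;> simp_all

theorem filter_blockWord [Fintype V] (Ss : List (V → Bool)) {p q : V}
    (h : ∀ S ∈ Ss, ¬(S p ∧ S q)) :
    (blockWord Ss).filter (fun z => decide (z = p ∨ z = q)) =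
      Ss.flatMap fun S => if S p then [p] else if S q then [q] else [] := by
  induction Ss with
  | nil => rfl
  | cons S Ss ih =>
    have ih' := ih fun T hT => h T (List.mem_cons_of_mem _ hT)
    unfold blockWord at ih' ⊢
    rw [List.flatMap_cons, List.filter_append, ih', List.flatMap_cons,
      filter_toList_pair S (h S List.mem_cons_self)]

theorem alternate_comm {w : List V} {p q : V} : Alternate w p q ↔ Alternate w q p := by
  unfold Alternate
  simp only [or_comm]

/-- The letters `p` and `q` occur in `w` in the pattern `pqpq⋯pq`. -/
def PairPattern (w : List V) (p q : V) : Prop :=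
  ∃ k, w.filter (fun z => decide (z = p ∨ z = q)) = (List.replicate k [p, q]).flatten

theorem PairPattern.append {w w' : List V} {p q : V} (h : PairPattern w p q)
    (h' : PairPattern w' p q) : PairPattern (w ++ w') p q := by
  obtain ⟨k, hk⟩ := h
  obtain ⟨k', hk'⟩ := h'
  exact ⟨k + k', by rw [List.filter_append, hk, hk', List.replicate_add, List.flatten_append]⟩

theorem PairPattern.flatMap {ι : Type*} (l : List ι) (f : ι → List V) {p q : V}
    (h : ∀ i ∈ l, PairPattern (f i) p q) : PairPattern (l.flatMap f) p q := by
  induction l with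
  | nil => exact ⟨0, rfl⟩
  | cons i l ih =>
    rw [List.flatMap_cons]
    exact (h i List.mem_cons_self).append (ih fun j hj => h j (List.mem_cons_of_mem _ hj))

theorem PairPattern.alternate {w : List V} {p q : V} (hpq : p ≠ q) (h : PairPattern w p q) :
    Alternate w p q := by
  obtain ⟨k, hk⟩ := h
  unfold Alternate
  rw [hk]
  clear hk
  induction k with
  | zero => exact List.IsChain.nil
  | succ k ih =>
    cases k with
    | zero => exact List.isChain_pair.2 hpq
    | succ k =>
      simp only [List.replicate_succ, List.flatten_cons, List.cons_append, List.nil_append] at ih ⊢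
      exact (ih.cons_cons hpq.symm).cons_cons hpq

theorem Alternate.of_infix_s9 {w w' : List V} {p q : V} (h : Alternate w p q) (hw : w' <:+: w) :
    Alternate w' p q :=
  List.IsChain.infix h (hw.filter _)

/-- If every non-edge is broken by a word respecting an orientation `r` of the edges, then
concatenating these words represents the graph. -/
theorem wordRepresentable_of_separating [Fintype V] (G : SimpleGraph V) (r : V → V → Prop)
    (hr : ∀ p q, G.Adj p q → r p q ∨ r q p) (w₀ : List V) (hmem : ∀ z, z ∈ w₀)
    (hw₀ : ∀ p q, G.Adj p q → r p q → PairPattern w₀ p q)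
    (h : ∀ u v, u ≠ v → ¬G.Adj u v →
      ∃ w : List V, (∀ p q, G.Adj p q → r p q → PairPattern w p q) ∧ ¬Alternate w u v) :
    WordRepresentable G := by
  classical
  have h' : ∀ e : {e : V × V // e.1 ≠ e.2 ∧ ¬G.Adj e.1 e.2}, ∃ w : List V,
      (∀ p q, G.Adj p q → r p q → PairPattern w p q) ∧ ¬Alternate w e.1.1 e.1.2 :=
    fun e => h _ _ e.2.1 e.2.2
  choose W hgood hbad using h'
  let w := w₀ ++ Finset.univ.toList.flatMap W
  have hw (p q : V) (ha : G.Adj p q) (hpq : r p q) : Alternate w p q :=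
    ((hw₀ p q ha hpq).append (PairPattern.flatMap _ _ fun e _ => hgood e p q ha hpq)).alternate ha.ne
  refine ⟨w, fun v => List.mem_append_left _ (hmem v), fun p q hne => ⟨fun ha => ?_, fun halt => ?_⟩⟩
  · rcases hr p q ha with h | h
    · exact hw p q ha h
    · exact alternate_comm.1 (hw q p ha.symm h)
  · by_contra ha
    refine hbad ⟨(p, q), hne, ha⟩ (halt.of_infix_s9 (List.IsInfix.trans ?_
      (List.suffix_append _ _).isInfix))
    exact List.infix_of_mem_flatten (List.mem_map.2 ⟨⟨(p, q), hne, ha⟩, by simp, rfl⟩)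

/-- The blocks `Ss` keep the pattern `pqpq` for all pairs of increasing colours other than `u, v`,
while `u` and `v` do not alternate. -/
def SeparatingBlocks (c : V → ℕ) (u v : V) (Ss : List (V → Bool)) : Prop :=
  (∀ p q, c p < c q → (p = u → q ≠ v) → (∀ S ∈ Ss, ¬(S p ∧ S q)) ∧
    (Ss.flatMap fun S => if S p then [p] else if S q then [q] else []) = [p, q, p, q]) ∧
  (∀ S ∈ Ss, ¬(S u ∧ S v)) ∧ ¬ List.IsChain (· ≠ ·)
    (Ss.flatMap fun S => if S u then [u] else if S v then [v] else [])

/-- Listing a colour class with `u` first and then with `u` last separates `u` from its class. -/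
theorem separatingBlocks_same {c : V → ℕ} (hc : ∀ v, c v < 3) {u v : V} (hne : u ≠ v)
    (huv : c u = c v) :
    SeparatingBlocks c u v [fun z => c z = 0 ∧ z = u, fun z => c z = 0 ∧ z ≠ u,
      fun z => c z = 1 ∧ z = u, fun z => c z = 1 ∧ z ≠ u,
      fun z => c z = 2 ∧ z = u, fun z => c z = 2 ∧ z ≠ u,
      fun z => c z = 0 ∧ z ≠ u, fun z => c z = 0 ∧ z = u,
      fun z => c z = 1 ∧ z ≠ u, fun z => c z = 1 ∧ z = u,
      fun z => c z = 2 ∧ z ≠ u, fun z => c z = 2 ∧ z = u] := by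
  refine ⟨fun p q hpq _ => ?_, ?_⟩
  · rcases color_cases hc hpq with ⟨hp, hq⟩ | ⟨hp, hq⟩ | ⟨hp, hq⟩ <;>
    by_cases hpu : p = u <;> by_cases hqu : q = u <;> simp [hp, hq, hpu, hqu] <;> simp_all
  · have := hc v
    have hv : c v = 0 ∨ c v = 1 ∨ c v = 2 := by omega
    rcases hv with hv | hv | hv <;> simp [huv, hv, hne.symm]

/-- The second pass swaps a vertex of colour `0` with one of colour `1`. -/
theorem separatingBlocks_zero_one {c : V → ℕ} (hc : ∀ v, c v < 3) {u v : V}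
    (hu : c u = 0) (hv : c v = 1) :
    SeparatingBlocks c u v [fun z => c z = 0, fun z => c z = 1, fun z => c z = 2,
      fun z => c z = 0 ∧ z ≠ u, fun z => z = v, fun z => z = u,
      fun z => c z = 1 ∧ z ≠ v, fun z => c z = 2] := by
  refine ⟨fun p q hpq hn => ?_, ?_⟩
  · have hqp : q ≠ p := by rintro rfl; exact lt_irrefl _ hpq
    rcases color_cases hc hpq with ⟨hp, hq⟩ | ⟨hp, hq⟩ | ⟨hp, hq⟩ <;> clear hpq hc <;>
    by_cases hpu : p = u <;> by_cases hqv : q = v <;>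
    by_cases hpv : p = v <;> by_cases hqu : q = u <;> simp_all
  · clear hc
    have hne : u ≠ v := by rintro rfl; simp_all
    simp [hu, hv, hne, hne.symm]

/-- The second pass swaps a vertex of colour `1` with one of colour `2`. -/
theorem separatingBlocks_one_two {c : V → ℕ} (hc : ∀ v, c v < 3) {u v : V}
    (hu : c u = 1) (hv : c v = 2) :
    SeparatingBlocks c u v [fun z => c z = 0, fun z => c z = 1, fun z => c z = 2,
      fun z => c z = 0, fun z => c z = 1 ∧ z ≠ u, fun z => z = v, fun z => z = u,
      fun z => c z = 2 ∧ z ≠ v] := by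
  refine ⟨fun p q hpq hn => ?_, ?_⟩
  · have hqp : q ≠ p := by rintro rfl; exact lt_irrefl _ hpq
    rcases color_cases hc hpq with ⟨hp, hq⟩ | ⟨hp, hq⟩ | ⟨hp, hq⟩ <;> clear hpq hc <;>
    by_cases hpu : p = u <;> by_cases hqv : q = v <;>
    by_cases hpv : p = v <;> by_cases hqu : q = u <;> simp_all
  · clear hc
    have hne : u ≠ v := by rintro rfl; simp_all
    simp [hu, hv, hne, hne.symm]

/-- Both occurrences of `u` precede both occurrences of `v`. -/
theorem separatingBlocks_zero_two {c : V → ℕ} (hc : ∀ v, c v < 3) {u v : V}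
    (hu : c u = 0) (hv : c v = 2) :
    SeparatingBlocks c u v [fun z => c z = 0, fun z => c z = 1, fun z => c z = 2 ∧ z ≠ v,
      fun z => z = u, fun z => z = v,
      fun z => c z = 0 ∧ z ≠ u, fun z => c z = 1, fun z => c z = 2] := by
  refine ⟨fun p q hpq hn => ?_, ?_⟩
  · have hqp : q ≠ p := by rintro rfl; exact lt_irrefl _ hpq
    rcases color_cases hc hpq with ⟨hp, hq⟩ | ⟨hp, hq⟩ | ⟨hp, hq⟩ <;> clear hpq hc <;>
    by_cases hpu : p = u <;> by_cases hqv : q = v <;>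
    by_cases hpv : p = v <;> by_cases hqu : q = u <;> simp_all
  · clear hc
    have hne : u ≠ v := by rintro rfl; simp_all
    simp [hu, hv, hne, hne.symm]

/-- Every non-edge `u v` of a graph coloured by `0, 1, 2` with `c u ≤ c v` is broken by a word in
which every edge occurs in the pattern prescribed by the colouring. -/
theorem exists_separating_word [Fintype V] (G : SimpleGraph V) (c : V → ℕ)
    (hc : ∀ v, c v < 3) {u v : V} (huv : c u ≤ c v) (hne : u ≠ v) (ha : ¬G.Adj u v) :
    ∃ w : List V, (∀ p q, G.Adj p q → c p < c q → PairPattern w p q) ∧ ¬Alternate w u v := by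
  obtain ⟨Ss, hpat, hdisj, hbad⟩ : ∃ Ss, SeparatingBlocks c u v Ss := by
    rcases huv.eq_or_lt with heq | hlt
    · exact ⟨_, separatingBlocks_same hc hne heq⟩
    · rcases color_cases hc hlt with ⟨hu, hv⟩ | ⟨hu, hv⟩ | ⟨hu, hv⟩
      · exact ⟨_, separatingBlocks_zero_one hc hu hv⟩
      · exact ⟨_, separatingBlocks_zero_two hc hu hv⟩
      · exact ⟨_, separatingBlocks_one_two hc hu hv⟩
  refine ⟨blockWord Ss, fun p q hpq hlt => ⟨2, ?_⟩, ?_⟩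
  · obtain ⟨h, h'⟩ := hpat p q hlt (by rintro rfl rfl; exact ha hpq)
    rw [filter_blockWord Ss h, h']
    rfl
  · unfold Alternate
    rw [filter_blockWord Ss hdisj]
    exact hbad

/-- A graph with a proper colouring by `0, 1, 2` is word-representable. -/
theorem wordRepresentable_of_three_coloring [Fintype V] (G : SimpleGraph V) (c : V → ℕ)
    (hc : ∀ v, c v < 3) (hadj : ∀ p q, G.Adj p q → c p ≠ c q) : WordRepresentable G := by
  refine wordRepresentable_of_separating G (fun p q => c p < c q)
    (fun p q h => lt_or_gt_of_ne (hadj p q h))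
    (blockWord [fun z => c z = 0, fun z => c z = 1, fun z => c z = 2]) ?_ ?_ ?_
  · intro z
    have := hc z
    have : c z = 0 ∨ c z = 1 ∨ c z = 2 := by omega
    simpa [blockWord] using this
  · intro p q _ hlt
    have := hc q
    have : (c p = 0 ∧ c q = 1) ∨ (c p = 0 ∧ c q = 2) ∨ (c p = 1 ∧ c q = 2) := by omega
    refine ⟨1, ?_⟩
    rw [filter_blockWord]
    all_goals rcases this with ⟨hp, hq⟩ | ⟨hp, hq⟩ | ⟨hp, hq⟩ <;> simp [hp, hq]
  · intro u v hne ha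
    rcases le_total (c u) (c v) with h | h
    · exact exists_separating_word G c hc h hne ha
    · obtain ⟨w, hw, hw'⟩ := exists_separating_word G c hc h hne.symm fun h => ha h.symm
      exact ⟨w, hw, fun h => hw' (alternate_comm.1 h)⟩

end Words

/-- If multiplication by `M` sends every jump of a circulant graph to a residue lying in the middle
third of `[0, N)`, then cutting the circle into three arcs gives a proper 3-colouring. -/
theorem wordRepresentable_circulantGraph_of_multiplier {N : ℕ} [NeZero N] (s : Set (ZMod N))
    (M : ZMod N) (h : ∀ d ∈ s, N ≤ 3 * (M * d).val ∧ 3 * (M * d).val ≤ 2 * N) :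
    WordRepresentable (SimpleGraph.circulantGraph s) := by
  have hN : 0 < N := Nat.pos_of_neZero N
  have key (a e : ZMod N) (h₁ : N ≤ 3 * e.val) (h₂ : 3 * e.val ≤ 2 * N) :
      3 * a.val / N ≠ 3 * (a + e).val / N := by
    intro heq
    have ha := Nat.div_add_mod (3 * a.val) N
    have hb := Nat.div_add_mod (3 * (a + e).val) N
    have ha' := Nat.mod_lt (3 * a.val) hN
    have hb' := Nat.mod_lt (3 * (a + e).val) hN
    rw [heq] at ha
    rcases lt_or_ge (a.val + e.val) N with hlt | hge
    · have := ZMod.val_add_of_lt hlt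
      omega
    · have := ZMod.val_add_val_of_le hge
      omega
  refine wordRepresentable_of_three_coloring _ (fun z => 3 * (M * z).val / N) (fun z => ?_) ?_
  · have := ZMod.val_lt (M * z)
    exact Nat.div_lt_of_lt_mul (by omega)
  · have step (p q : ZMod N) (hd : p - q ∈ s) : 3 * (M * q).val / N ≠ 3 * (M * p).val / N := by
      have := key (M * q) (M * (p - q)) (h _ hd).1 (h _ hd).2
      rwa [← mul_add, add_sub_cancel] at this
    intro p q hpq
    rw [SimpleGraph.circulantGraph_adj] at hpq
    rcases hpq.2 with hd | hd
    · exact (step p q hd).symm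
    · exact step q p hd

/-- The first term of the progression `r, r + m, r + 2m, …` whose multiple by `y` reaches `L`. -/
theorem exists_progression_mul_ge (r m L : ℕ) {y : ℕ} (hm : 0 < m) (hy : 0 < y) :
    ∃ j, L ≤ (r + m * j) * y ∧ (j = 0 ∨ (r + m * j) * y < L + m * y) := by
  have hex : ∃ j, L ≤ (r + m * j) * y :=
    ⟨L, by nlinarith [Nat.mul_le_mul hm hy, Nat.zero_le (r * y), Nat.zero_le L]⟩
  refine ⟨Nat.find hex, Nat.find_spec hex, ?_⟩
  rcases hj : Nat.find hex with _ | j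
  · exact Or.inl rfl
  · right
    have := Nat.find_min hex (m := j) (by omega)
    nlinarith

/-- An odd multiplier sending `1` and `x` to the middle third of the residues modulo `2n`. -/
theorem exists_odd_multiplier {n x : ℕ} (h0 : n % 3 = 1) (h1 : x % 3 = 2) (h2 : 2 < x)
    (h3 : 2 * x < n) :
    ∃ M q r : ℕ, M % 2 = 1 ∧ 2 * n ≤ 3 * M ∧ 3 * M ≤ 4 * n ∧
      M * x = 2 * n * q + r ∧ 2 * n ≤ 3 * r ∧ 3 * r ≤ 4 * n := by
  rcases Nat.even_or_odd' x with ⟨a, hx | hx⟩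
  · rcases le_or_gt (3 * x) n with hsmall | hlarge
    · obtain ⟨t, hpar, hlow, hup⟩ : ∃ t, (n + t) % 2 = 1 ∧ 2 * n ≤ t * (3 * x) ∧
          t * (3 * x) < 2 * n + 2 * (3 * x) := by
        obtain ⟨j, hj, hj'⟩ := exists_progression_mul_ge ((n + 1) % 2) 2 (2 * n) (y := 3 * x)
          (by omega) (by omega)
        refine ⟨(n + 1) % 2 + 2 * j, by omega, hj, hj'.resolve_left ?_⟩
        rintro rfl
        have : (n + 1) % 2 < 2 := Nat.mod_lt _ (by omega)
        interval_cases (n + 1) % 2 <;> omega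
      have ht : 3 * t ≤ n := by
        by_contra! hcon
        obtain ⟨k, rfl⟩ : ∃ k, t = k + 2 := ⟨t - 2, by omega⟩
        have : k * (3 * 8) ≤ k * (3 * x) := Nat.mul_le_mul_left _ (by omega)
        rw [add_mul] at hup
        omega
      refine ⟨n + t, a, t * x, hpar, by omega, by omega, by subst hx; ring, by linarith,
        by linarith⟩
    · rcases Nat.even_or_odd' n with ⟨h, hn | hn⟩
      · obtain ⟨δ, rfl⟩ : ∃ δ, h = x + δ := ⟨h - x, by omega⟩
        obtain ⟨j, hj, hj'⟩ := exists_progression_mul_ge 3 4 n (y := 6 * δ)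
          (by omega) (by omega)
        have hup : (3 + 4 * j) * (6 * δ) ≤ 5 * n := by
          rcases hj' with rfl | hj' <;> omega
        have ht : 3 * (3 + 4 * j) ≤ n := by
          rcases hj' with rfl | hj'
          · omega
          · rcases j with _ | i
            · omega
            · have : (3 + 4 * i) * 6 ≤ (3 + 4 * i) * (6 * δ) := Nat.mul_le_mul_left _ (by omega)
              have : (3 + 4 * i) * (6 * δ) < n := by linarith
              omega
        obtain ⟨r, hr⟩ : ∃ r, 3 * (x + δ) = r + (3 + 4 * j) * δ :=
          ⟨3 * (x + δ) - (3 + 4 * j) * δ, by have : (3 + 4 * j) * δ ≤ 3 * (x + δ) := by linarith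
                                             omega⟩
        refine ⟨n + (3 + 4 * j), a + j, r, by omega, by omega, by omega, ?_, by linarith,
          by linarith⟩
        subst hn
        zify at hx hr ⊢
        linear_combination 2 * ((x : ℤ) + δ) * hx + hr
      · exact ⟨n + 2, a, 2 * x, by omega, by omega, by omega, by subst hx; ring, by omega,
          by omega⟩
  · rcases Nat.even_or_odd' n with ⟨h, hn | hn⟩
    · rcases le_or_gt (3 * x) n with hsmall | hlarge
      · exact ⟨n + 1, a, n + x, by omega, by omega, by omega, by subst hx; ring, by omega,
          by omega⟩
      · obtain ⟨δ, rfl⟩ : ∃ δ, h = x + δ := ⟨h - x, by omega⟩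
        obtain ⟨j, hj, hj'⟩ := exists_progression_mul_ge 1 4 n (y := 6 * δ)
          (by omega) (by omega)
        have hj' := hj'.resolve_left (by rintro rfl; omega)
        have ht : 3 * (1 + 4 * j) ≤ n := by
          rcases j with _ | i
          · omega
          · have : (1 + 4 * i) * 6 ≤ (1 + 4 * i) * (6 * δ) := Nat.mul_le_mul_left _ (by omega)
            have : (1 + 4 * i) * (6 * δ) < n := by linarith
            omega
        obtain ⟨r, hr⟩ : ∃ r, 3 * (x + δ) = r + (1 + 4 * j) * δ :=
          ⟨3 * (x + δ) - (1 + 4 * j) * δ, by have : (1 + 4 * j) * δ ≤ 3 * (x + δ) := by linarith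
                                             omega⟩
        refine ⟨n + (1 + 4 * j), a + j, r, by omega, by omega, by omega, ?_, by linarith,
          by linarith⟩
        subst hn
        zify at hx hr ⊢
        linear_combination 2 * ((x : ℤ) + δ) * hx + hr
    · exact ⟨n, a, n, by omega, by omega, by omega, by subst hx; ring, by omega, by omega⟩

theorem stmt9 (n x : ℕ) (hn : 3 ≤ n) (hx1 : 1 < x) (hxn : x < n)
    (h0 : n % 3 = 1) (h1 : x % 3 = 2) (h2 : 2 < x) (h3 : 2*x < n) :
    WordRepresentable (SimpleGraph.circulantGraph {((1 : ℕ) : ZMod (2*n)), ((x : ℕ) : ZMod (2*n)), ((n : ℕ) : ZMod (2*n))}) := by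
  have : NeZero (2 * n) := ⟨by omega⟩
  obtain ⟨M, q, r, hodd, hM, hM', hMx, hr, hr'⟩ := exists_odd_multiplier h0 h1 h2 h3
  refine wordRepresentable_circulantGraph_of_multiplier _ (M : ZMod (2 * n)) ?_
  have hval (d q e : ℕ) (h : M * d = 2 * n * q + e) (he : 2 * n ≤ 3 * e) (he' : 3 * e ≤ 4 * n) :
      2 * n ≤ 3 * ((M : ZMod (2 * n)) * d).val ∧
        3 * ((M : ZMod (2 * n)) * d).val ≤ 2 * (2 * n) := by
    rw [← Nat.cast_mul, ZMod.val_natCast, h, Nat.mul_add_mod, Nat.mod_eq_of_lt (by omega)]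
    omega
  rintro d (rfl | rfl | rfl)
  · exact hval 1 0 M (by ring) hM hM'
  · exact hval x q r hMx hr hr'
  · refine hval n (M / 2) n ?_ (by omega) (by omega)
    have hdiv : M = 2 * (M / 2) + 1 := by omega
    nth_rewrite 1 [hdiv]
    ring
end
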